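/- Let P₀, P₁ ∈ CC₊ with P₀ ≠ R̄₊ⁿ and P₁ ≠ R̄₊ⁿ. Then for a given t ∈ (0,1), equality Covol(P_t^⊕) = (1−t)·Covol(P₀) + t·Covol(P₁) holds if and only if P₀ = P₁; in particular, if P₀ ≠ P₁ then the inequality Covol(P_t^⊕) < (1−t)·Covol(P₀) + t·Covol(P₁) is strict for every t ∈ (0,1). -/

import Mathlib

open Set MeasureTheory Pointwise

noncomputable section

abbrev En (n : ℕ) := EuclideanSpace ℝ (Fin n)

/-- Standard inner product on ℝⁿ. -/
def dotp {n : ℕ} (x y : En n) : ℝ := ∑ i, x i * y i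

/-- Closed positive orthant R̄₊ⁿ. -/
def posOrthantCl (n : ℕ) : Set (En n) := {x | ∀ i, 0 ≤ x i}
/-- Open positive orthant R₊ⁿ. -/
def posOrthantOp (n : ℕ) : Set (En n) := {x | ∀ i, 0 < x i}
/-- Closed negative orthant R̄₋ⁿ. -/
def negOrthantCl (n : ℕ) : Set (En n) := {x | ∀ i, x i ≤ 0}
/-- Open negative orthant R₋ⁿ. -/
def negOrthantOp (n : ℕ) : Set (En n) := {x | ∀ i, x i < 0}

/-- Copolar A° = {x : ⟨x,y⟩ ≤ −1 for all y ∈ A}. -/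
def copolar {n : ℕ} (A : Set (En n)) : Set (En n) := {x | ∀ y ∈ A, dotp x y ≤ -1}

/-- Membership in C₊: closed convex subset of R̄₊ⁿ with A + R₊ⁿ ⊆ A. -/
def memCplus {n : ℕ} (A : Set (En n)) : Prop :=
  IsClosed A ∧ Convex ℝ A ∧ A ⊆ posOrthantCl n ∧ A + posOrthantOp n ⊆ A

/-- Membership in C₋: closed convex subset of R̄₋ⁿ with A + R₋ⁿ ⊆ A. -/
def memCminus {n : ℕ} (A : Set (En n)) : Prop :=
  IsClosed A ∧ Convex ℝ A ∧ A ⊆ negOrthantCl n ∧ A + negOrthantOp n ⊆ A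

/-- Membership in CC₊: member of C₊ with bounded complement in R̄₊ⁿ. -/
def memCCplus {n : ℕ} (P : Set (En n)) : Prop :=
  memCplus P ∧ Bornology.IsBounded (posOrthantCl n \ P)

/-- Membership in UC₋: nonempty member of C₋ contained in s* + R̄₋ⁿ for some s* ∈ R₋ⁿ. -/
def memUCminus {n : ℕ} (L : Set (En n)) : Prop :=
  L.Nonempty ∧ memCminus L ∧ ∃ s ∈ negOrthantOp n, L ⊆ s +ᵥ negOrthantCl n

/-- Support function of a set, with values in EReal. -/
def suppFn {n : ℕ} (A : Set (En n)) (x : En n) : EReal := ⨆ y ∈ A, ((dotp x y : ℝ) : EReal)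

/-- Legendre transform of an EReal-valued function. -/
def legendre {n : ℕ} (f : En n → EReal) (y : En n) : EReal :=
  ⨆ x, ((dotp x y : ℝ) : EReal) - f x
theorem dotp_eq_inner {n : ℕ} (x y : En n) : dotp x y = inner ℝ x y := by
  simp [dotp, PiLp.inner_apply, mul_comm]

theorem isClosed_posOrthantCl {n : ℕ} : IsClosed (posOrthantCl n) := by
  simp only [posOrthantCl, ofPred_forall]
  exact isClosed_iInter fun i => isClosed_le continuous_const (by fun_prop)

theorem isOpen_posOrthantOp {n : ℕ} : IsOpen (posOrthantOp n) := by
  simp only [posOrthantOp, ofPred_forall]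
  exact isOpen_iInter_of_finite fun i => isOpen_lt continuous_const (by fun_prop)

theorem not_isBounded_posOrthantCl {n : ℕ} (hn : 1 ≤ n) : ¬ Bornology.IsBounded (posOrthantCl n) := by
  intro h
  obtain ⟨R, hR⟩ := h.exists_norm_le
  have h1 := hR (EuclideanSpace.single ⟨0, hn⟩ (|R| + 1)) fun i => by
    by_cases hi : i = ⟨0, hn⟩ <;> simp [hi]
    positivity
  rw [PiLp.norm_single, Real.norm_of_nonneg (by positivity)] at h1
  linarith [le_abs_self R]

theorem memCCplus.nonempty {n : ℕ} (hn : 1 ≤ n) {P : Set (En n)} (h : memCCplus P) : P.Nonempty := by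
  rw [Set.nonempty_iff_ne_empty]
  rintro rfl
  exact not_isBounded_posOrthantCl hn (by simpa using h.2)

theorem tendsto_add_smul_one {n : ℕ} (x : En n) :
    Filter.Tendsto (fun s : ℝ => x + s • WithLp.toLp 2 (fun _ : Fin n => (1 : ℝ)))
      (nhdsWithin 0 (Ioi 0)) (nhds x) := by
  have : Continuous (fun s : ℝ => x + s • WithLp.toLp 2 (fun _ : Fin n => (1 : ℝ))) := by fun_prop
  simpa using (this.tendsto 0).mono_left nhdsWithin_le_nhds

theorem memCplus.add_mem {n : ℕ} {P : Set (En n)} (h : memCplus P) {p c : En n} (hp : p ∈ P)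
    (hc : c ∈ posOrthantCl n) : p + c ∈ P := by
  refine h.1.mem_of_tendsto (tendsto_add_smul_one (p + c)) ?_
  filter_upwards [self_mem_nhdsWithin] with s hs
  rw [add_assoc]
  refine h.2.2.2 (add_mem_add hp fun i => ?_)
  have := hc i
  have hs : 0 < s := hs
  simp
  positivity

theorem memCplus.zero_notMem {n : ℕ} {P : Set (En n)} (h : memCplus P) (hP : P ≠ posOrthantCl n) :
    (0 : En n) ∉ P := fun h0 =>
  hP (h.2.2.1.antisymm fun c hc => by simpa using h.add_mem h0 hc)

theorem nonneg_of_forall_le_add_mul {a b u : ℝ} (h : ∀ s : ℝ, 0 ≤ s → u ≤ a + s * b) : 0 ≤ b := by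
  by_contra! hb
  have h1 := h ((|a - u| + 1) / (-b)) (div_nonneg (by positivity) (by linarith))
  have h2 : (|a - u| + 1) / (-b) * b = -(|a - u| + 1) := by
    have : b ≠ 0 := hb.ne
    field_simp
  rw [h2] at h1
  linarith [le_abs_self (a - u)]

theorem memCplus.copolar_subset {n : ℕ} {P : Set (En n)} (h : memCplus P) (hne : P.Nonempty) :
    copolar P ⊆ negOrthantCl n := by
  obtain ⟨p, hp⟩ := hne
  intro x hx i
  suffices 0 ≤ -x i by linarith
  refine nonneg_of_forall_le_add_mul (a := -dotp x p) (u := 1) fun s hs => ?_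
  have h1 := hx _ (h.add_mem hp (c := EuclideanSpace.single i s) fun j => by
    by_cases hj : j = i <;> simp [hj, hs])
  have h2 : dotp x (EuclideanSpace.single i s) = s * x i := by
    simp [dotp_eq_inner, EuclideanSpace.inner_single_right]
  rw [dotp_eq_inner, inner_add_right, ← dotp_eq_inner, ← dotp_eq_inner, h2] at h1
  linarith

/-- Points of the orthant outside a complete set are separated from it by its copolar. -/
theorem memCplus.exists_copolar {n : ℕ} {P : Set (En n)} (h : memCplus P) (hne : P.Nonempty)
    {y : En n} (hy : y ∈ posOrthantCl n) (hyP : y ∉ P) : ∃ x ∈ copolar P, -1 < dotp x y := by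
  obtain ⟨f, u, hfy, hf⟩ := geometric_hahn_banach_point_closed h.2.1 h.1 hyP
  obtain ⟨p, hp⟩ := hne
  have hf0 : 0 ≤ f y := by
    refine nonneg_of_forall_le_add_mul (a := f p) (u := u) fun s hs => ?_
    have := hf _ (h.add_mem hp (c := s • y) fun j => by
      have := hy j
      simp
      positivity)
    simpa using this.le
  have hu : 0 < u := hf0.trans_lt hfy
  have key : ∀ z, dotp (-(u⁻¹ • (InnerProductSpace.toDual ℝ (En n)).symm f)) z = -(f z / u) := by
    intro z
    rw [dotp_eq_inner, inner_neg_left, real_inner_smul_left, InnerProductSpace.toDual_symm_apply]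
    ring
  refine ⟨-(u⁻¹ • (InnerProductSpace.toDual ℝ (En n)).symm f), fun z hz => ?_, ?_⟩
  · rw [key]
    have := (one_lt_div hu).2 (hf z hz)
    linarith
  · rw [key]
    have := (div_lt_one hu).2 hfy
    linarith

theorem memCplus.copolar_copolar_inter {n : ℕ} {P : Set (En n)} (h : memCplus P) (hne : P.Nonempty) :
    posOrthantCl n \ copolar (copolar P) = posOrthantCl n \ P := by
  ext y
  refine and_congr_right fun hy => not_congr ⟨fun hyP => ?_, fun hyP x hx => ?_⟩
  · by_contra hn
    obtain ⟨x, hx, hxy⟩ := h.exists_copolar hne hy hn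
    have := hyP x hx
    rw [dotp_eq_inner, real_inner_comm, ← dotp_eq_inner] at this
    linarith
  · rw [dotp_eq_inner, real_inner_comm, ← dotp_eq_inner]
    exact hx y hyP

/-- The positively homogeneous function `y ↦ inf_{a ∈ A} ⟨-a, y⟩⁺`. -/
def cogauge {n : ℕ} (A : Set (En n)) (y : En n) : ℝ := ⨅ a : A, max (-dotp y a) 0

theorem bddBelow_cogauge {n : ℕ} (A : Set (En n)) (y : En n) :
    BddBelow (range fun a : A => max (-dotp y a) 0) :=
  ⟨0, by rintro _ ⟨a, rfl⟩; exact le_max_right _ _⟩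

theorem cogauge_nonneg {n : ℕ} (A : Set (En n)) (y : En n) : 0 ≤ cogauge A y :=
  Real.iInf_nonneg fun _ => le_max_right _ _

theorem measurable_cogauge {n : ℕ} (A : Set (En n)) : Measurable (cogauge A) := by
  refine UpperSemicontinuous.measurable ?_
  refine upperSemicontinuous_ciInf (bddBelow_cogauge A) fun a => Continuous.upperSemicontinuous ?_
  simp only [dotp]
  fun_prop

theorem cogauge_smul {n : ℕ} (A : Set (En n)) {s : ℝ} (hs : 0 ≤ s) (y : En n) :
    cogauge A (s • y) = s * cogauge A y := by
  rw [cogauge, cogauge, Real.mul_iInf_of_nonneg hs]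
  congr 1 with a
  rw [mul_max_of_nonneg _ _ hs, dotp_eq_inner, dotp_eq_inner, real_inner_smul_left]
  simp

theorem dotp_nonpos {n : ℕ} {x y : En n} (hy : y ∈ posOrthantCl n) (hx : x ∈ negOrthantCl n) :
    dotp y x ≤ 0 :=
  Finset.sum_nonpos fun i _ => mul_nonpos_of_nonneg_of_nonpos (hy i) (hx i)

theorem diff_copolar_eq {n : ℕ} {A : Set (En n)} (hA : A.Nonempty) :
    posOrthantCl n \ copolar A = posOrthantCl n ∩ {y | cogauge A y < 1} := by
  have := hA.to_subtype
  ext y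
  refine and_congr_right fun hy => ?_
  simp only [copolar, mem_ofPred_eq, not_forall, not_le]
  constructor
  · rintro ⟨a, ha, h⟩
    exact (ciInf_le (bddBelow_cogauge A y) ⟨a, ha⟩).trans_lt (max_lt (by linarith) one_pos)
  · intro h
    obtain ⟨a, h⟩ := exists_lt_of_ciInf_lt h
    exact ⟨a, a.2, by linarith [(max_lt_iff.1 h).1]⟩

theorem cogauge_add {n : ℕ} {A B : Set (En n)} (hA : A.Nonempty) (hB : B.Nonempty)
    (hA' : A ⊆ negOrthantCl n) (hB' : B ⊆ negOrthantCl n) {s t : ℝ} (hs : 0 ≤ s) (ht : 0 ≤ t)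
    {y : En n} (hy : y ∈ posOrthantCl n) :
    cogauge (s • A + t • B) y = s * cogauge A y + t * cogauge B y := by
  have := hA.to_subtype
  have := hB.to_subtype
  have := (hA.smul_set (a := s)).add (hB.smul_set (a := t)) |>.to_subtype
  have key : ∀ a ∈ A, ∀ b ∈ B, max (-dotp y (s • a + t • b)) 0
      = s * max (-dotp y a) 0 + t * max (-dotp y b) 0 := by
    intro a ha b hb
    have h1 := dotp_nonpos hy (hA' ha)
    have h2 := dotp_nonpos hy (hB' hb)
    have h3 : dotp y (s • a + t • b) = s * dotp y a + t * dotp y b := by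
      simp only [dotp_eq_inner, inner_add_right, real_inner_smul_right]
    rw [h3, max_eq_left (by nlinarith), max_eq_left (by linarith), max_eq_left (by linarith)]
    ring
  apply le_antisymm
  · rw [cogauge, cogauge, cogauge, Real.mul_iInf_of_nonneg hs, Real.mul_iInf_of_nonneg ht]
    refine le_ciInf_add_ciInf fun a b => ?_
    rw [← key a a.2 b b.2]
    exact ciInf_le (bddBelow_cogauge _ y)
      ⟨_, add_mem_add (smul_mem_smul_set a.2) (smul_mem_smul_set b.2)⟩
  · refine le_ciInf ?_
    rintro ⟨_, _, ⟨a, ha, rfl⟩, _, ⟨b, hb, rfl⟩, rfl⟩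
    dsimp only
    rw [key a ha b hb]
    gcongr
    · exact ciInf_le (bddBelow_cogauge A y) ⟨a, ha⟩
    · exact ciInf_le (bddBelow_cogauge B y) ⟨b, hb⟩

/-- The sublevel sets of a cogauge in the orthant scale like dilates of the unit one. -/
theorem volume_inter_cogauge_lt {n : ℕ} (A : Set (En n)) {s : ℝ} (hs : 0 < s) :
    volume (posOrthantCl n ∩ {y | cogauge A y < s})
      = ENNReal.ofReal (s ^ n) * volume (posOrthantCl n ∩ {y | cogauge A y < 1}) := by
  have : posOrthantCl n ∩ {y | cogauge A y < s}
      = s • (posOrthantCl n ∩ {y | cogauge A y < 1}) := by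
    ext y
    rw [mem_smul_set_iff_inv_smul_mem₀ hs.ne']
    refine and_congr ?_ ?_
    · refine forall_congr' fun i => ?_
      simp [hs]
    · rw [mem_ofPred_eq, mem_ofPred_eq, cogauge_smul _ (by positivity), inv_mul_lt_one₀ hs]
  rw [this, Measure.addHaar_smul_of_nonneg _ hs.le, finrank_euclideanSpace_fin]

/-- The constant `n!` as an extended nonnegative real, in integral form. -/
def gammaConst (n : ℕ) : ENNReal :=
  ∫⁻ s in Ioi (0 : ℝ), ENNReal.ofReal (Real.exp (-s)) * ENNReal.ofReal (s ^ n)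

theorem gammaConst_ne_zero (n : ℕ) : gammaConst n ≠ 0 := by
  rw [gammaConst, ← pos_iff_ne_zero, setLIntegral_pos_iff (by fun_prop)]
  have : Function.support (fun s : ℝ => ENNReal.ofReal (Real.exp (-s)) * ENNReal.ofReal (s ^ n))
      ∩ Ioi 0 = Ioi 0 := by
    refine inter_eq_right.2 fun s hs => ?_
    have hs : 0 < s := hs
    simp [Real.exp_pos, pow_pos hs]
  rw [this]
  simp

theorem gammaConst_ne_top (n : ℕ) : gammaConst n ≠ ⊤ := by
  have h := (Real.GammaIntegral_convergent (s := n + 1) (by positivity)).lintegral_lt_top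
  refine ne_of_lt (lt_of_eq_of_lt ?_ h)
  refine lintegral_congr fun s => ?_
  rw [← ENNReal.ofReal_mul (Real.exp_pos _).le]
  simp

theorem lintegral_exp_neg_cogauge {n : ℕ} (A : Set (En n)) :
    ∫⁻ y in posOrthantCl n, ENNReal.ofReal (Real.exp (-cogauge A y))
      = gammaConst n * volume (posOrthantCl n ∩ {y | cogauge A y < 1}) := by
  have hm := measurable_cogauge A
  have hC := (isClosed_posOrthantCl (n := n)).measurableSet
  let F : En n → ℝ → ENNReal := fun y s =>
    {p : En n × ℝ | cogauge A p.1 < p.2}.indicator (fun p => ENNReal.ofReal (Real.exp (-p.2))) (y, s)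
  have hset : MeasurableSet {p : En n × ℝ | cogauge A p.1 < p.2} :=
    measurableSet_lt (by fun_prop) (by fun_prop)
  have hF : Measurable (Function.uncurry F) :=
    Measurable.indicator (by fun_prop) hset
  have h1 : ∀ y, ENNReal.ofReal (Real.exp (-cogauge A y)) = ∫⁻ s in Ioi (0 : ℝ), F y s := by
    intro y
    have hexp : IntegrableOn (fun s => Real.exp (-s)) (Ioi (cogauge A y)) :=
      integrableOn_exp_neg_Ioi _
    rw [← integral_exp_neg_Ioi, ofReal_integral_eq_lintegral_ofReal hexp
      (Filter.Eventually.of_forall fun s => (Real.exp_pos _).le),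
      ← lintegral_indicator measurableSet_Ioi, ← lintegral_indicator measurableSet_Ioi]
    refine lintegral_congr fun s => ?_
    have h0 := cogauge_nonneg A y
    by_cases hs : cogauge A y < s
    · simp [F, indicator, hs, h0.trans_lt hs]
    · simp [F, indicator, hs]
  simp only [h1]
  rw [lintegral_lintegral_swap hF.aemeasurable, gammaConst,
    ← lintegral_mul_const _ (by fun_prop)]
  refine setLIntegral_congr_fun measurableSet_Ioi fun s hs => ?_
  have h2 : ∀ y, F y s = {y | cogauge A y < s}.indicator
      (fun _ => ENNReal.ofReal (Real.exp (-s))) y := by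
    intro y
    simp [F, indicator]
  simp only [h2]
  rw [lintegral_indicator_const (measurableSet_lt hm measurable_const),
    Measure.restrict_apply (measurableSet_lt hm measurable_const), inter_comm,
    volume_inter_cogauge_lt A hs, mul_assoc]

/-- If `P` is not contained in `Q`, then `P \ Q` has positive measure. -/
theorem memCplus.volume_diff_pos {n : ℕ} {P Q : Set (En n)} (hP : memCplus P) (hQ : memCplus Q)
    (h : ¬ P ⊆ Q) : 0 < volume (P \ Q) := by
  obtain ⟨y, hyP, hyQ⟩ := not_subset.1 h
  have hopen : IsOpen ((y +ᵥ posOrthantOp n) ∩ Qᶜ) :=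
    (isOpen_posOrthantOp.vadd y).inter hQ.1.isOpen_compl
  have hne : ((y +ᵥ posOrthantOp n) ∩ Qᶜ).Nonempty := by
    have h1 := (tendsto_add_smul_one y).eventually (hQ.1.isOpen_compl.mem_nhds hyQ)
    obtain ⟨s, h1, hs⟩ := (h1.and self_mem_nhdsWithin).exists
    refine ⟨_, ?_, h1⟩
    refine vadd_mem_vadd_set (fun i => ?_)
    simpa using hs
  refine (hopen.measure_pos volume hne).trans_le (measure_mono (inter_subset_inter_left _ ?_))
  rintro _ ⟨c, hc, rfl⟩
  exact hP.2.2.2 (add_mem_add hyP hc)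

theorem exp_neg_add_le {t a b : ℝ} (ht : t ∈ Ioo (0 : ℝ) 1) :
    Real.exp (-((1 - t) * a + t * b)) ≤ (1 - t) * Real.exp (-a) + t * Real.exp (-b) := by
  have := convexOn_exp.2 (mem_univ (-a)) (mem_univ (-b)) (sub_nonneg.2 ht.2.le) ht.1.le (by ring)
  simp only [smul_eq_mul] at this
  rwa [show -((1 - t) * a + t * b) = (1 - t) * -a + t * -b by ring]

theorem exp_neg_add_lt {t a b : ℝ} (ht : t ∈ Ioo (0 : ℝ) 1) (hab : a ≠ b) :
    Real.exp (-((1 - t) * a + t * b)) < (1 - t) * Real.exp (-a) + t * Real.exp (-b) := by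
  have := strictConvexOn_exp.2 (mem_univ (-a)) (mem_univ (-b)) (neg_injective.ne hab)
    (sub_pos.2 ht.2) ht.1 (by ring)
  simp only [smul_eq_mul] at this
  rwa [show -((1 - t) * a + t * b) = (1 - t) * -a + t * -b by ring]

theorem volume_diff_copolar_combination_lt {n : ℕ} {A B : Set (En n)} (hA : A.Nonempty) (hB : B.Nonempty)
    (hA' : A ⊆ negOrthantCl n) (hB' : B ⊆ negOrthantCl n)
    (hAv : volume (posOrthantCl n \ copolar A) ≠ ⊤) (hBv : volume (posOrthantCl n \ copolar B) ≠ ⊤)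
    (hne : volume (posOrthantCl n ∩ {y | cogauge A y ≠ cogauge B y}) ≠ 0)
    {t : ℝ} (ht : t ∈ Ioo (0 : ℝ) 1) :
    volume (posOrthantCl n \ copolar ((1 - t) • A + t • B))
      < ENNReal.ofReal (1 - t) * volume (posOrthantCl n \ copolar A)
        + ENNReal.ofReal t * volume (posOrthantCl n \ copolar B) := by
  have hmA := measurable_cogauge A
  have hmB := measurable_cogauge B
  have ht0 := ht.1
  have ht1 : 0 < 1 - t := sub_pos.2 ht.2
  have hC := (isClosed_posOrthantCl (n := n)).measurableSet
  rw [diff_copolar_eq hA, diff_copolar_eq hB,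
    diff_copolar_eq ((hA.smul_set (a := 1 - t)).add (hB.smul_set (a := t)))] at *
  rw [← ENNReal.mul_lt_mul_iff_right (gammaConst_ne_zero n) (gammaConst_ne_top n), mul_add,
    mul_left_comm, mul_left_comm (gammaConst n), ← lintegral_exp_neg_cogauge,
    ← lintegral_exp_neg_cogauge, ← lintegral_exp_neg_cogauge,
    ← lintegral_const_mul _ (by fun_prop), ← lintegral_const_mul _ (by fun_prop),
    ← lintegral_add_left (by fun_prop)]
  have hcomb : ∀ y, ENNReal.ofReal (1 - t) * ENNReal.ofReal (Real.exp (-cogauge A y))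
      + ENNReal.ofReal t * ENNReal.ofReal (Real.exp (-cogauge B y))
      = ENNReal.ofReal ((1 - t) * Real.exp (-cogauge A y) + t * Real.exp (-cogauge B y)) := by
    intro y
    rw [ENNReal.ofReal_add (by positivity) (by positivity), ENNReal.ofReal_mul ht1.le,
      ENNReal.ofReal_mul ht0.le]
  have hle : ∀ᵐ y ∂volume.restrict (posOrthantCl n),
      ENNReal.ofReal (Real.exp (-cogauge ((1 - t) • A + t • B) y))
        ≤ ENNReal.ofReal (1 - t) * ENNReal.ofReal (Real.exp (-cogauge A y))
          + ENNReal.ofReal t * ENNReal.ofReal (Real.exp (-cogauge B y)) := by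
    refine (ae_restrict_iff' hC).2 (Filter.Eventually.of_forall fun y hy => ?_)
    rw [hcomb, cogauge_add hA hB hA' hB' ht1.le ht0.le hy]
    exact ENNReal.ofReal_le_ofReal (exp_neg_add_le ht)
  refine lintegral_strict_mono_of_ae_le_of_ae_lt_on (s := {y | cogauge A y ≠ cogauge B y})
    (by fun_prop) (ne_of_lt ((lintegral_mono_ae hle).trans_lt ?_)) hle ?_ ?_
  · rw [lintegral_add_left (by fun_prop), lintegral_const_mul _ (by fun_prop),
      lintegral_const_mul _ (by fun_prop), lintegral_exp_neg_cogauge, lintegral_exp_neg_cogauge]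
    have := gammaConst_ne_top n
    finiteness
  · rwa [Measure.restrict_apply' hC, inter_comm]
  · refine (ae_restrict_iff' hC).2 (Filter.Eventually.of_forall fun y hy hy' => ?_)
    rw [hcomb, cogauge_add hA hB hA' hB' ht1.le ht0.le hy]
    exact (ENNReal.ofReal_lt_ofReal_iff (by positivity)).2 (exp_neg_add_lt ht hy')

theorem memCplus.volume_cogauge_copolar_ne {n : ℕ} {P Q : Set (En n)} (hP : memCplus P) (hQ : memCplus Q)
    (hPn : (copolar P).Nonempty) (hQn : (copolar Q).Nonempty) (hP0 : P.Nonempty)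
    (hQ0 : Q.Nonempty) (h : ¬ P ⊆ Q) :
    volume (posOrthantCl n ∩ {y | cogauge (copolar P) y ≠ cogauge (copolar Q) y}) ≠ 0 := by
  refine ((hP.volume_diff_pos hQ h).trans_le (measure_mono ?_)).ne'
  rintro y ⟨hyP, hyQ⟩
  have hy := hP.2.2.1 hyP
  refine ⟨hy, fun heq => ?_⟩
  have h1 : y ∈ posOrthantCl n ∩ {y | cogauge (copolar Q) y < 1} := by
    rw [← diff_copolar_eq hQn, hQ.copolar_copolar_inter hQ0]
    exact ⟨hy, hyQ⟩
  have h2 : y ∈ posOrthantCl n ∩ {y | cogauge (copolar P) y < 1} := ⟨hy, heq.trans_lt h1.2⟩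
  rw [← diff_copolar_eq hPn, hP.copolar_copolar_inter hP0] at h2
  exact h2.2 hyP

theorem diff_copolar_combination_self {n : ℕ} {A : Set (En n)} (hA : A.Nonempty)
    (hA' : A ⊆ negOrthantCl n) {t : ℝ} (ht : t ∈ Ioo (0 : ℝ) 1) :
    posOrthantCl n \ copolar ((1 - t) • A + t • A) = posOrthantCl n \ copolar A := by
  rw [diff_copolar_eq hA, diff_copolar_eq ((hA.smul_set (a := 1 - t)).add (hA.smul_set (a := t)))]
  ext y
  refine and_congr_right fun hy => ?_
  rw [mem_ofPred_eq, mem_ofPred_eq,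
    cogauge_add hA hA hA' hA' (sub_nonneg.2 ht.2.le) ht.1.le hy, ← add_mul, sub_add_cancel, one_mul]

/-- For P₀, P₁ ∈ CC₊ different from R̄₊ⁿ and t ∈ (0,1), equality
Covol(P_t^⊕) = (1−t)·Covol(P₀) + t·Covol(P₁) holds iff P₀ = P₁; in particular,
if P₀ ≠ P₁ the inequality is strict for every t ∈ (0,1). -/
theorem covol_copolar_combination_eq_iff (n : ℕ) (hn : 1 ≤ n) (P0 P1 : Set (En n))
    (h0 : memCCplus P0) (h1 : memCCplus P1)
    (h0' : P0 ≠ posOrthantCl n) (h1' : P1 ≠ posOrthantCl n) :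
    (∀ t ∈ Set.Ioo (0:ℝ) 1,
      (volume (posOrthantCl n \ copolar ((1 - t) • copolar P0 + t • copolar P1))
        = ENNReal.ofReal (1 - t) * volume (posOrthantCl n \ P0)
          + ENNReal.ofReal t * volume (posOrthantCl n \ P1) ↔ P0 = P1)) ∧
    (P0 ≠ P1 → ∀ t ∈ Set.Ioo (0:ℝ) 1,
      volume (posOrthantCl n \ copolar ((1 - t) • copolar P0 + t • copolar P1))
        < ENNReal.ofReal (1 - t) * volume (posOrthantCl n \ P0)
          + ENNReal.ofReal t * volume (posOrthantCl n \ P1)) := by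
  have hP0 := h0.nonempty hn
  have hP1 := h1.nonempty hn
  have hz : (0 : En n) ∈ posOrthantCl n := fun i => le_rfl
  have hA : (copolar P0).Nonempty :=
    (h0.1.exists_copolar hP0 hz (h0.1.zero_notMem h0')).imp fun _ h => h.1
  have hB : (copolar P1).Nonempty :=
    (h1.1.exists_copolar hP1 hz (h1.1.zero_notMem h1')).imp fun _ h => h.1
  have hA' := h0.1.copolar_subset hP0
  have hB' := h1.1.copolar_subset hP1
  have e0 := h0.1.copolar_copolar_inter hP0
  have e1 := h1.1.copolar_copolar_inter hP1
  have strict : P0 ≠ P1 → ∀ t ∈ Set.Ioo (0:ℝ) 1,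
      volume (posOrthantCl n \ copolar ((1 - t) • copolar P0 + t • copolar P1))
        < ENNReal.ofReal (1 - t) * volume (posOrthantCl n \ P0)
          + ENNReal.ofReal t * volume (posOrthantCl n \ P1) := by
    intro hne t ht
    rw [← e0, ← e1]
    refine volume_diff_copolar_combination_lt hA hB hA' hB' (by rw [e0]; exact h0.2.measure_lt_top.ne)
      (by rw [e1]; exact h1.2.measure_lt_top.ne) ?_ ht
    by_cases h : P0 ⊆ P1
    · have h' : ¬ P1 ⊆ P0 := fun h' => hne (h.antisymm h')
      simpa only [ne_comm] using
        h1.1.volume_cogauge_copolar_ne h0.1 hB hA hP1 hP0 h'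
    · exact h0.1.volume_cogauge_copolar_ne h1.1 hA hB hP0 hP1 h
  refine ⟨fun t ht => ⟨fun heq => ?_, ?_⟩, strict⟩
  · by_contra hne
    exact (strict hne t ht).ne heq
  · rintro rfl
    rw [diff_copolar_combination_self hA hA' ht, e0, ← add_mul,
      ← ENNReal.ofReal_add (sub_nonneg.2 ht.2.le) ht.1.le, sub_add_cancel, ENNReal.ofReal_one,
      one_mul]
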